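/- arXiv:1605.01981 — 5 statements merged into one kernel-verified Lean document; each statement's English description precedes it below -/
import Mathlib

section
/- Let α, β, γ > 0 be real, t > 0, and s ∈ ℕ. Then the s-th raw moment of the Prabhakar-type distribution satisfies ∑_{k=0}^∞ k^s (γ)_k t^{αk} / (k! Γ(αk+β)) = ∑_{j=0}^s (γ)_j S(s,j) t^{αj} E_{α, αj+β}^{γ+j}(t^α), where S(s,j) denotes the Stirling number of the second kind. -/
open scoped BigOperators

/-- Pochhammer symbol `(γ)_k = Γ(γ+k)/Γ(γ)`. -/
noncomputable def poch (γ : ℝ) (k : ℕ) : ℝ := Real.Gamma (γ + k) / Real.Gamma γ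

/-- The Prabhakar (three-parameter Mittag-Leffler) function
`E_{α,β}^γ(x) = ∑_{k≥0} (γ)_k x^k / (k! Γ(αk+β))`. -/
noncomputable def prabhakar (α β γ x : ℝ) : ℝ :=
  ∑' k : ℕ, poch γ k * x ^ k / (k.factorial * Real.Gamma (α * k + β))

/-- Stirling number of the second kind `S(s,j) = (1/j!) ∑_{m=0}^j (-1)^{j-m} C(j,m) m^s`. -/
noncomputable def stirlingSecond (s j : ℕ) : ℝ :=
  (1 / (j.factorial : ℝ)) * ∑ m ∈ Finset.range (j + 1),
    (-1 : ℝ) ^ (j - m) * (j.choose m : ℝ) * (m : ℝ) ^ s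

lemma natCast_pow_eq_sum_stirlingSecond_mul_descFactorial (s k : ℕ) :
    (k : ℝ) ^ s = ∑ j ∈ Finset.range (s + 1), stirlingSecond s j * (k.descFactorial j : ℝ) := by
  have hd (j : ℕ) : stirlingSecond s j * (k.descFactorial j : ℝ)
      = (k.choose j : ℝ) * (fwdDiff (1 : ℝ))^[j] (fun r : ℝ => r ^ s) 0 := by
    rw [fwdDiff_iter_eq_sum_shift, Nat.descFactorial_eq_factorial_mul_choose, stirlingSecond]
    have hj : (j.factorial : ℝ) ≠ 0 := by positivity
    simp only [zsmul_eq_mul, Nat.cast_mul, nsmul_eq_mul, mul_one, zero_add, Int.cast_mul,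
      Int.cast_pow, Int.cast_neg, Int.cast_one, Int.cast_natCast]
    field_simp
  have hlarge (j : ℕ) (hj : s < j) :
      (k.choose j : ℝ) * (fwdDiff (1 : ℝ))^[j] (fun r : ℝ => r ^ s) 0 = 0 := by
    rw [fwdDiff_iter_pow_eq_zero_of_lt hj, Pi.zero_apply, mul_zero]
  have newton := shift_eq_sum_fwdDiff_iter (1 : ℝ) (fun r : ℝ => r ^ s) k 0
  simp only [nsmul_eq_mul, mul_one, zero_add] at newton
  rw [newton, Finset.sum_congr rfl fun j _ => hd j]
  trans ∑ j ∈ Finset.range (max k s + 1),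
      (k.choose j : ℝ) * (fwdDiff (1 : ℝ))^[j] (fun r : ℝ => r ^ s) 0
  · refine Finset.sum_subset (Finset.range_mono (by omega)) fun j _ hj => ?_
    rw [Finset.mem_range, not_lt] at hj
    rw [Nat.choose_eq_zero_of_lt (by omega), Nat.cast_zero, zero_mul]
  · refine (Finset.sum_subset (Finset.range_mono (by omega)) fun j _ hj => ?_).symm
    rw [Finset.mem_range, not_lt] at hj
    exact hlarge j (by omega)

lemma poch_pos {γ : ℝ} (hγ : 0 < γ) (k : ℕ) : 0 < poch γ k :=
  div_pos (Real.Gamma_pos_of_pos (by positivity)) (Real.Gamma_pos_of_pos hγ)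

lemma poch_succ {γ : ℝ} (hγ : 0 < γ) (k : ℕ) : poch γ (k + 1) = (γ + k) * poch γ k := by
  have h : γ + k ≠ 0 := by positivity
  rw [poch, poch, Nat.cast_succ, ← add_assoc, Real.Gamma_add_one h, mul_div_assoc]

lemma poch_add {γ : ℝ} (hγ : 0 < γ) (m j : ℕ) :
    poch γ (m + j) = poch γ j * poch (γ + j) m := by
  have h : Real.Gamma (γ + j) ≠ 0 := (Real.Gamma_pos_of_pos (by positivity)).ne'
  have h' : Real.Gamma γ ≠ 0 := (Real.Gamma_pos_of_pos hγ).ne'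
  rw [poch, poch, poch, Nat.cast_add, show γ + ((m : ℝ) + j) = γ + j + m by ring]
  field_simp

/-- Log-convexity bounds the growth of the Gamma function over a step of length `a`. -/
lemma rpow_mul_Gamma_le_Gamma_add {a y : ℝ} (ha : 0 < a) (hy : 1 < y) :
    (y - 1) ^ a * Real.Gamma y ≤ Real.Gamma (y + a) := by
  have hy1 : 0 < y - 1 := by linarith
  have hΓ : 0 < Real.Gamma (y - 1) := Real.Gamma_pos_of_pos hy1
  have hΓy : 0 < Real.Gamma y := Real.Gamma_pos_of_pos (by linarith)
  have hΓa : 0 < Real.Gamma (y + a) := Real.Gamma_pos_of_pos (by linarith)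
  have hslope := Real.convexOn_log_Gamma.slope_mono_adjacent (x := y - 1) (y := y) (z := y + a)
    hy1 (show 0 < y + a by linarith) (by linarith) (by linarith)
  have hrec : Real.Gamma y = (y - 1) * Real.Gamma (y - 1) := by
    rw [← Real.Gamma_add_one hy1.ne', sub_add_cancel]
  have hlog : Real.log (Real.Gamma y) = Real.log (y - 1) + Real.log (Real.Gamma (y - 1)) := by
    rw [hrec, Real.log_mul hy1.ne' hΓ.ne']
  simp only [Function.comp_apply, sub_sub_cancel, div_one, add_sub_cancel_left] at hslope
  rw [le_div_iff₀ ha] at hslope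
  rw [← Real.log_le_log_iff (by positivity) hΓa,
    Real.log_mul (Real.rpow_pos_of_pos hy1 a).ne' hΓy.ne', Real.log_rpow hy1]
  nlinarith

lemma summable_prabhakar {α β γ x : ℝ} (hα : 0 < α) (hβ : 0 < β) (hγ : 0 < γ) (hx : 0 < x) :
    Summable fun k : ℕ => poch γ k * x ^ k / (k.factorial * Real.Gamma (α * k + β)) := by
  have hΓ (k : ℕ) : 0 < Real.Gamma (α * k + β) := Real.Gamma_pos_of_pos (by positivity)
  have hpos (k : ℕ) : 0 < poch γ k * x ^ k / (k.factorial * Real.Gamma (α * k + β)) := by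
    have := poch_pos hγ k
    have := hΓ k
    positivity
  have harg : Filter.Tendsto (fun k : ℕ => α * k + β - 1) Filter.atTop Filter.atTop := by
    simp only [add_sub_assoc]
    exact Filter.tendsto_atTop_add_const_right _ _
      (tendsto_natCast_atTop_atTop.const_mul_atTop hα)
  have hbound : Filter.Tendsto (fun k : ℕ => (γ + 1) * x * (α * k + β - 1) ^ (-α))
      Filter.atTop (nhds 0) := by
    simpa using ((tendsto_rpow_neg_atTop hα).comp harg).const_mul ((γ + 1) * x)
  refine summable_of_ratio_test_tendsto_lt_one zero_lt_one
    (Filter.Eventually.of_forall fun k => (hpos k).ne') ?_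
  refine squeeze_zero' (Filter.Eventually.of_forall fun k => by positivity) ?_ hbound
  filter_upwards [harg.eventually_gt_atTop 0] with k hk
  rw [Real.norm_of_nonneg (hpos _).le, Real.norm_of_nonneg (hpos _).le, div_le_iff₀ (hpos k)]
  have hgrowth := rpow_mul_Gamma_le_Gamma_add hα (y := α * k + β) (by linarith)
  have hp := poch_pos hγ k
  have hpow : 0 < (α * k + β - 1) ^ α := Real.rpow_pos_of_pos hk α
  have hnum : γ + k ≤ (γ + 1) * (k + 1) := by nlinarith [(Nat.cast_nonneg k : (0 : ℝ) ≤ k)]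
  rw [poch_succ hγ, Nat.factorial_succ, Nat.cast_mul, Nat.cast_succ, pow_succ,
    show α * ((k : ℝ) + 1) + β = α * k + β + α by ring, Real.rpow_neg hk.le]
  have hΓk := hΓ k
  calc
    (γ + k) * poch γ k * (x ^ k * x)
          / (((k : ℝ) + 1) * k.factorial * Real.Gamma (α * k + β + α))
        ≤ (γ + 1) * (k + 1) * poch γ k * (x ^ k * x)
          / (((k : ℝ) + 1) * k.factorial
            * ((α * k + β - 1) ^ α * Real.Gamma (α * k + β))) := by
      gcongr
    _ = _ := by field_simp

lemma hasSum_descFactorial_mul_prabhakar_term {α β γ t : ℝ} (hα : 0 < α) (hβ : 0 < β)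
    (hγ : 0 < γ) (ht : 0 < t) (j : ℕ) :
    HasSum (fun k : ℕ => (k.descFactorial j : ℝ) *
        (poch γ k * t ^ (α * k) / (k.factorial * Real.Gamma (α * k + β))))
      (poch γ j * t ^ (α * j) * prabhakar α (α * j + β) (γ + j) (t ^ α)) := by
  rw [← (add_left_injective j).hasSum_iff]
  · have hsum := (summable_prabhakar (β := α * j + β) (γ := γ + j) hα (by positivity)
      (by positivity) (Real.rpow_pos_of_pos ht α)).hasSum.mul_left (poch γ j * t ^ (α * j))
    refine hsum.congr_fun fun m => ?_
    have hfac : ((m + j).factorial : ℝ) = m.factorial * ((m + j).descFactorial j : ℝ) := by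
      rw [← Nat.cast_mul]
      simpa using congrArg (Nat.cast (R := ℝ))
        (Nat.factorial_mul_descFactorial (Nat.le_add_left j m)).symm
    have hdesc : ((m + j).descFactorial j : ℝ) ≠ 0 := by
      rw [Nat.cast_ne_zero, Ne, Nat.descFactorial_eq_zero_iff_lt]
      omega
    have hΓ : Real.Gamma (α * m + (α * j + β)) ≠ 0 :=
      (Real.Gamma_pos_of_pos (by positivity)).ne'
    simp only [Function.comp_apply]
    rw [poch_add hγ, hfac, Nat.cast_add,
      show α * ((m : ℝ) + j) + β = α * m + (α * j + β) by ring, mul_add α, Real.rpow_add ht,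
      Real.rpow_mul_natCast ht.le α m]
    field_simp
  · intro k hk
    have hkj : k < j := by
      by_contra! h
      exact hk ⟨k - j, Nat.sub_add_cancel h⟩
    rw [Nat.descFactorial_of_lt hkj, Nat.cast_zero, zero_mul]

/-- The s-th raw moment series of the Prabhakar-type distribution in terms of Stirling numbers
of the second kind and Prabhakar functions. -/
theorem prabhakar_raw_moment (α β γ t : ℝ) (hα : 0 < α) (hβ : 0 < β) (hγ : 0 < γ)
    (ht : 0 < t) (s : ℕ) :
    ∑' k : ℕ, (k : ℝ) ^ s * poch γ k * t ^ (α * k) / (k.factorial * Real.Gamma (α * k + β))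
      = ∑ j ∈ Finset.range (s + 1),
          poch γ j * stirlingSecond s j * t ^ (α * j) * prabhakar α (α * j + β) (γ + j) (t ^ α) := by
  have hsum := hasSum_sum fun j (_ : j ∈ Finset.range (s + 1)) =>
    (hasSum_descFactorial_mul_prabhakar_term hα hβ hγ ht j).mul_left (stirlingSecond s j)
  convert hsum.tsum_eq using 1
  · refine tsum_congr fun k => ?_
    rw [mul_assoc, mul_div_assoc, natCast_pow_eq_sum_stirlingSecond_mul_descFactorial,
      Finset.sum_mul]
    exact Finset.sum_congr rfl fun j _ => by rw [mul_assoc]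
  · exact Finset.sum_congr rfl fun j _ => by ring
end

section
/- Let α, β, γ > 0 be real and t ∈ (0,1). Then E_{α,β}^γ(t^α) ≤ 1 / (Γ₀ (1 - t^α)^γ), where Γ₀ = inf_{n ∈ ℕ} Γ(αn + β). -/
open scoped BigOperators

/-- `Γ_p = inf_{n ∈ ℕ, n ≥ p} Γ(αn + β)`. -/
noncomputable def gammaInf (α β : ℝ) (p : ℕ) : ℝ :=
  ⨅ n : {m : ℕ // p ≤ m}, Real.Gamma (α * (n : ℕ) + β)

theorem poch_eq_ascPochhammer_eval {γ : ℝ} (hγ : 0 < γ) (k : ℕ) :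
    poch γ k = (ascPochhammer ℝ k).eval γ := by
  induction k with
  | zero => simp [poch, (Real.Gamma_pos_of_pos hγ).ne']
  | succ k ih =>
    have hk : γ + k ≠ 0 := by positivity
    rw [ascPochhammer_succ_eval, ← ih, poch, poch, Nat.cast_succ, ← add_assoc,
      Real.Gamma_add_one hk]
    ring

theorem poch_div_factorial_eq_choose {γ : ℝ} (hγ : 0 < γ) (k : ℕ) :
    poch γ k / k.factorial = Ring.choose (γ + k - 1) k := by
  rw [← Ring.multichoose_eq, div_eq_iff (by positivity), poch_eq_ascPochhammer_eval hγ,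
    ← Polynomial.ascPochhammer_smeval_eq_eval,
    ← Ring.factorial_nsmul_multichoose_eq_ascPochhammer, nsmul_eq_mul, mul_comm]

/-- The negative binomial series. -/
theorem hasSum_poch_mul_pow_div_factorial {γ x : ℝ} (hγ : 0 < γ) (hx : |x| < 1) :
    HasSum (fun k : ℕ ↦ poch γ k * x ^ k / k.factorial) (1 / (1 - x) ^ γ) := by
  have h := (Real.one_div_one_sub_rpow_hasFPowerSeriesOnBall_zero γ).hasSum (y := x)
    (by simpa [enorm_eq_nnnorm, ← NNReal.coe_lt_coe] using hx)
  simp only [zero_add, FormalMultilinearSeries.ofScalars_apply_eq, smul_eq_mul] at h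
  refine h.congr_fun fun k ↦ ?_
  rw [← poch_div_factorial_eq_choose hγ]
  ring

theorem exists_pos_forall_le_Gamma : ∃ c : ℝ, 0 < c ∧ ∀ s : ℝ, 0 < s → c ≤ Real.Gamma s := by
  obtain ⟨x, hx, hmin⟩ := Real.exists_isMinOn_Gamma_Ioi
  exact ⟨Real.Gamma x, Real.Gamma_pos_of_pos (by linarith [hx.1]), fun s hs ↦ hmin hs⟩

theorem gammaInf_pos {α β : ℝ} (hα : 0 ≤ α) (hβ : 0 < β) (p : ℕ) : 0 < gammaInf α β p := by
  obtain ⟨c, hc, hle⟩ := exists_pos_forall_le_Gamma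
  have : Nonempty {m : ℕ // p ≤ m} := ⟨⟨p, le_rfl⟩⟩
  exact hc.trans_le (le_ciInf fun n ↦ hle _ (by positivity))

theorem gammaInf_le {α β : ℝ} (hα : 0 ≤ α) (hβ : 0 < β) {p n : ℕ} (hn : p ≤ n) :
    gammaInf α β p ≤ Real.Gamma (α * n + β) := by
  refine ciInf_le (f := fun m : {m : ℕ // p ≤ m} ↦ Real.Gamma (α * (m : ℕ) + β)) ⟨0, ?_⟩ ⟨n, hn⟩
  rintro _ ⟨m, rfl⟩
  exact Real.Gamma_nonneg_of_nonneg (by positivity)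

/-- Upper bound for the Prabhakar function on `(0,1)`:
`E_{α,β}^γ(t^α) ≤ 1/(Γ₀ (1-t^α)^γ)` with `Γ₀ = inf_{n∈ℕ} Γ(αn+β)`. -/
theorem prabhakar_upper_bound (α β γ t : ℝ) (hα : 0 < α) (hβ : 0 < β) (hγ : 0 < γ)
    (ht : t ∈ Set.Ioo (0 : ℝ) 1) :
    prabhakar α β γ (t ^ α) ≤ 1 / (gammaInf α β 0 * (1 - t ^ α) ^ γ) := by
  have hx0 : 0 < t ^ α := Real.rpow_pos_of_pos ht.1 α
  have hx1 : t ^ α < 1 := Real.rpow_lt_one ht.1.le ht.2 hα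
  generalize t ^ α = x at hx0 hx1
  have hΓ := gammaInf_pos hα.le hβ 0
  have hsum := (hasSum_poch_mul_pow_div_factorial hγ (abs_lt.2 ⟨by linarith, hx1⟩)).div_const
    (gammaInf α β 0)
  have hpoch (k : ℕ) : 0 ≤ poch γ k :=
    div_nonneg (Real.Gamma_nonneg_of_nonneg (by positivity)) (Real.Gamma_nonneg_of_nonneg hγ.le)
  have hle (k : ℕ) : poch γ k * x ^ k / (k.factorial * Real.Gamma (α * k + β)) ≤
      poch γ k * x ^ k / k.factorial / gammaInf α β 0 := by
    rw [← div_div]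
    exact div_le_div_of_nonneg_left (by have := hpoch k; positivity) hΓ
      (gammaInf_le hα.le hβ k.zero_le)
  have hnonneg (k : ℕ) : 0 ≤ poch γ k * x ^ k / (k.factorial * Real.Gamma (α * k + β)) := by
    have := hpoch k
    have := Real.Gamma_pos_of_pos (s := α * k + β) (by positivity)
    positivity
  calc prabhakar α β γ x ≤ 1 / (1 - x) ^ γ / gammaInf α β 0 :=
        ((hsum.summable.of_nonneg_of_le hnonneg hle).tsum_le_tsum hle hsum.summable).trans_eq
          hsum.tsum_eq
    _ = 1 / (gammaInf α β 0 * (1 - x) ^ γ) := by rw [div_div, mul_comm]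
end

section
/- Let α ≥ 1, γ > 0, and β > 0 be real with the Gamma function nondecreasing on [β, ∞) (which holds exactly when β ≥ t₀, t₀ being the unique positive minimum point of Γ). Then for all t > 0, E_{α,β}^γ(t^α) ≤ (1/Γ(β)) · ₁F₁(γ; β; t^α). -/
open scoped BigOperators

/-- Kummer's confluent hypergeometric function `₁F₁(a;b;z) = ∑_{k≥0} ((a)_k/(b)_k) z^k/k!`. -/
noncomputable def kummer (a b z : ℝ) : ℝ :=
  ∑' k : ℕ, (poch a k / poch b k) * z ^ k / k.factorial

lemma poch_pos_s5 {c : ℝ} (hc : 0 < c) (k : ℕ) : 0 < poch c k :=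
  div_pos (Real.Gamma_pos_of_pos (by positivity)) (Real.Gamma_pos_of_pos hc)

/-- The power series defining `₁F₁(a;b;z)` converges for every positive `z`. -/
lemma summable_kummer {a b z : ℝ} (ha : 0 < a) (hb : 0 < b) (hz : 0 < z) :
    Summable fun k : ℕ => (poch a k / poch b k) * z ^ k / k.factorial := by
  have hpos (k : ℕ) : 0 < (poch a k / poch b k) * z ^ k / k.factorial := by
    have := poch_pos_s5 ha k
    have := poch_pos_s5 hb k
    positivity
  have hsucc {c : ℝ} (hc : 0 < c) (k : ℕ) : poch c (k + 1) = (c + k) * poch c k := by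
    simp only [poch, Nat.cast_add, Nat.cast_one, ← add_assoc]
    rw [Real.Gamma_add_one (by positivity), mul_div_assoc]
  have hlim : Filter.Tendsto (fun k : ℕ => (1 + (a - b) / (b + k)) * (z / ((k : ℝ) + 1)))
      Filter.atTop (nhds ((1 + 0) * 0)) := by
    have hk := tendsto_natCast_atTop_atTop (R := ℝ)
    exact (tendsto_const_nhds.add
      ((Filter.tendsto_atTop_add_const_left _ b hk).const_div_atTop _)).mul
      ((Filter.tendsto_atTop_add_const_right _ 1 hk).const_div_atTop _)
  refine summable_of_ratio_test_tendsto_lt_one (l := (1 + 0) * 0) (by norm_num)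
    (.of_forall fun k => (hpos k).ne') (hlim.congr fun k => ?_)
  rw [Real.norm_of_nonneg (hpos _).le, Real.norm_of_nonneg (hpos _).le, hsucc ha, hsucc hb,
    Nat.factorial_succ, pow_succ]
  have hA := (poch_pos_s5 ha k).ne'
  have hB := (poch_pos_s5 hb k).ne'
  have : b + k ≠ 0 := by positivity
  push_cast
  field_simp
  ring

/-- Kummer-type upper bound for the Prabhakar function:
`E_{α,β}^γ(t^α) ≤ (1/Γ(β)) ₁F₁(γ;β;t^α)` for `α ≥ 1` and `Γ` nondecreasing on `[β,∞)`. -/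
theorem prabhakar_kummer_bound (α β γ : ℝ) (hα : 1 ≤ α) (hβ : 0 < β) (hγ : 0 < γ)
    (hmono : MonotoneOn Real.Gamma (Set.Ici β)) (t : ℝ) (ht : 0 < t) :
    prabhakar α β γ (t ^ α) ≤ (1 / Real.Gamma β) * kummer γ β (t ^ α) := by
  have hx : 0 < t ^ α := Real.rpow_pos_of_pos ht α
  have hΓβ := Real.Gamma_pos_of_pos hβ
  have hle (k : ℕ) : poch γ k * (t ^ α) ^ k / (k.factorial * Real.Gamma (α * k + β)) ≤
      (1 / Real.Gamma β) * ((poch γ k / poch β k) * (t ^ α) ^ k / k.factorial) := by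
    have hk : (k : ℝ) ≤ α * k := le_mul_of_one_le_left k.cast_nonneg hα
    have hk0 : (0 : ℝ) ≤ k := k.cast_nonneg
    have hΓk : 0 < Real.Gamma (β + k) := Real.Gamma_pos_of_pos (by positivity)
    have hp := poch_pos_s5 hγ k
    have hΓ : Real.Gamma (β + k) ≤ Real.Gamma (α * k + β) :=
      hmono (Set.mem_Ici.2 (by linarith)) (Set.mem_Ici.2 (by linarith)) (by linarith)
    calc _ ≤ poch γ k * (t ^ α) ^ k / (k.factorial * Real.Gamma (β + k)) := by gcongr
      _ = _ := by
        rw [show poch β k = Real.Gamma (β + k) / Real.Gamma β from rfl]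
        field_simp
  have hsum := (summable_kummer hγ hβ hx).mul_left (1 / Real.Gamma β)
  have hnonneg (k : ℕ) :
      0 ≤ poch γ k * (t ^ α) ^ k / (k.factorial * Real.Gamma (α * k + β)) := by
    have := Real.Gamma_pos_of_pos (show 0 < α * k + β by positivity)
    have hp := poch_pos_s5 hγ k
    positivity
  rw [prabhakar, kummer, ← tsum_mul_left]
  exact (Summable.of_nonneg_of_le hnonneg hle hsum).tsum_le_tsum hle hsum
end

section
/- Let α, β, γ > 0 be real and t > 0. Writing F(t) = E_{α,β}^γ(t) with first and second derivatives F'(t) and F''(t), the first-order Laguerre inequality holds in the form F(t) · [ F'(t) + t F''(t) ] ≥ t (F'(t))². -/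
open scoped BigOperators

/-- The coefficient sequence of the derivative of `∑ c k * x ^ k`. -/
noncomputable def derivCoeff (c : ℕ → ℝ) (k : ℕ) : ℝ := (k + 1) * c (k + 1)

/-- The coefficients `c` define a power series converging on all of `ℝ`. -/
def EntireCoeff (c : ℕ → ℝ) : Prop := ∀ r : ℝ, 0 < r → Summable fun k => |c k| * r ^ k

lemma EntireCoeff.summable_natCast_mul {c : ℕ → ℝ} (hc : EntireCoeff c) {r : ℝ} (hr : 0 < r) :
    Summable fun k : ℕ => (k : ℝ) * (|c k| * r ^ k) := by
  refine Summable.of_nonneg_of_le (fun k => by positivity) (fun k => ?_)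
    (hc (2 * r) (by positivity))
  have h : (k : ℝ) ≤ 2 ^ k := by exact_mod_cast Nat.lt_two_pow_self.le
  rw [mul_pow]
  calc (k : ℝ) * (|c k| * r ^ k) ≤ 2 ^ k * (|c k| * r ^ k) := by gcongr
    _ = _ := by ring

lemma EntireCoeff.natCast_mul {c : ℕ → ℝ} (hc : EntireCoeff c) :
    EntireCoeff fun k => k * c k := by
  intro r hr
  simpa [abs_mul, mul_assoc] using hc.summable_natCast_mul hr

lemma EntireCoeff.entire_derivCoeff {c : ℕ → ℝ} (hc : EntireCoeff c) : EntireCoeff (derivCoeff c) := by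
  intro r hr
  have h := ((summable_nat_add_iff 1).2 (hc.natCast_mul r hr)).mul_right r⁻¹
  refine h.congr fun k => ?_
  simp only [derivCoeff]
  push_cast
  rw [pow_succ]
  field_simp

lemma EntireCoeff.summable {c : ℕ → ℝ} (hc : EntireCoeff c) (x : ℝ) :
    Summable fun k => c k * x ^ k := by
  refine Summable.of_norm_bounded (hc (|x| + 1) (by positivity)) fun k => ?_
  rw [Real.norm_eq_abs, abs_mul, abs_pow]
  gcongr
  linarith

lemma EntireCoeff.hasDerivAt {c : ℕ → ℝ} (hc : EntireCoeff c) (x : ℝ) :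
    HasDerivAt (fun y => ∑' k, c k * y ^ k) (∑' k, derivCoeff c k * x ^ k) x := by
  have hr : (1 : ℝ) ≤ |x| + 1 := by linarith [abs_nonneg x]
  have hd := hasDerivAt_tsum_of_isPreconnected
    (g := fun k y => c k * y ^ k) (g' := fun k y => c k * (k * y ^ (k - 1)))
    (t := Metric.ball 0 (|x| + 1)) (y₀ := 0) (y := x)
    (hc.summable_natCast_mul (r := |x| + 1) (by positivity)) Metric.isOpen_ball
    (convex_ball _ _).isPreconnected (fun k y _ => (hasDerivAt_pow k y).const_mul _)
    (fun k y hy => ?_) (by simp; positivity) (hc.summable 0) (by simp)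
  · refine hd.congr_deriv ?_
    rw [tsum_eq_zero_add' (M := ℝ) (f := fun k : ℕ => c k * ((k : ℝ) * x ^ (k - 1)))]
    · simp only [derivCoeff, Nat.cast_zero, zero_mul, mul_zero, zero_add, add_tsub_cancel_right]
      exact tsum_congr fun k => by push_cast; ring
    · refine (hc.entire_derivCoeff.summable x).congr fun k => ?_
      simp only [derivCoeff, add_tsub_cancel_right]
      push_cast
      ring
  · have hy' : |y| ≤ |x| + 1 := by simpa using (Metric.mem_ball.1 hy).le
    rw [Real.norm_eq_abs, abs_mul, abs_mul, abs_pow, Nat.abs_cast]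
    calc |c k| * (k * |y| ^ (k - 1)) ≤ |c k| * (k * (|x| + 1) ^ (k - 1)) := by gcongr
      _ ≤ |c k| * (k * (|x| + 1) ^ k) := by
        gcongr
        exact Nat.sub_le k 1
      _ = _ := by ring

/-- The Laguerre inequality for an entire power series with nonnegative coefficients, at a
positive point. -/
lemma EntireCoeff.laguerre {c : ℕ → ℝ} (hc : EntireCoeff c) (hpos : ∀ k, 0 ≤ c k) {t : ℝ}
    (ht : 0 < t) :
    t * (∑' k, derivCoeff c k * t ^ k) ^ 2 ≤
      (∑' k, c k * t ^ k) * ((∑' k, derivCoeff c k * t ^ k)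
        + t * ∑' k, derivCoeff (derivCoeff c) k * t ^ k) := by
  have shift {d : ℕ → ℝ} (hd : EntireCoeff d) :
      t * ∑' k, derivCoeff d k * t ^ k = ∑' k : ℕ, k * d k * t ^ k := by
    rw [(hd.natCast_mul.summable t).tsum_eq_zero_add, ← tsum_mul_left]
    simp only [derivCoeff, Nat.cast_zero, zero_mul, zero_add]
    exact tsum_congr fun k => by push_cast; ring
  have h0 := hc.summable t
  have h1 := hc.natCast_mul.summable t
  have h2 := hc.natCast_mul.natCast_mul.summable t
  have e1 := shift hc
  have e2 : t * ((∑' k, derivCoeff c k * t ^ k)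
        + t * ∑' k, derivCoeff (derivCoeff c) k * t ^ k)
      = ∑' k : ℕ, k * (k * c k) * t ^ k := by
    rw [← shift hc.natCast_mul, shift hc.entire_derivCoeff,
      ← (hc.entire_derivCoeff.summable t).tsum_add (hc.entire_derivCoeff.natCast_mul.summable t)]
    congr 1
    refine tsum_congr fun k => ?_
    simp only [derivCoeff]
    push_cast
    ring
  have quad (x : ℝ) : 0 ≤ (∑' k, c k * t ^ k) * (x * x)
      + (-2 * ∑' k : ℕ, k * c k * t ^ k) * x + ∑' k : ℕ, k * (k * c k) * t ^ k := by
    rw [← tsum_mul_right, ← tsum_mul_left, ← tsum_mul_right,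
      ← (h0.mul_right _).tsum_add ((h1.mul_left _).mul_right _),
      ← ((h0.mul_right _).add ((h1.mul_left _).mul_right _)).tsum_add h2]
    refine tsum_nonneg fun k => ?_
    have : 0 ≤ c k * t ^ k * (x - k) ^ 2 :=
      mul_nonneg (mul_nonneg (hpos k) (by positivity)) (sq_nonneg _)
    linarith
  have hdisc := discrim_le_zero quad
  rw [discrim, ← e1, ← e2] at hdisc
  refine le_of_mul_le_mul_left ?_ ht
  linarith

lemma exp_neg_mul_rpow_le_Gamma {M x : ℝ} (hM : 0 < M) (hx : 1 ≤ x) :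
    Real.exp (-M) * M ^ (x - 1) ≤ Real.Gamma x := by
  rw [Real.Gamma_eq_integral (by linarith), ← integral_exp_neg_Ioi,
    ← MeasureTheory.integral_mul_const]
  have hint := Real.GammaIntegral_convergent (s := x) (by linarith)
  have hsub : Set.Ioi M ⊆ Set.Ioi 0 := Set.Ioi_subset_Ioi hM.le
  refine le_trans (MeasureTheory.setIntegral_mono_on ?_ (hint.mono_set hsub) measurableSet_Ioi
    fun y hy => ?_) (MeasureTheory.setIntegral_mono_set hint ?_ hsub.eventuallyLE)
  · exact (integrableOn_exp_neg_Ioi M).mul_const _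
  · have : M < y := hy
    gcongr
  · filter_upwards [MeasureTheory.ae_restrict_mem measurableSet_Ioi] with y hy
    have : 0 < y := hy
    simp only [Pi.zero_apply]
    positivity

lemma poch_nonneg {γ : ℝ} (hγ : 0 < γ) (k : ℕ) : 0 ≤ poch γ k :=
  div_nonneg (Real.Gamma_pos_of_pos (by positivity)).le (Real.Gamma_pos_of_pos hγ).le

lemma poch_le {γ : ℝ} (hγ : 0 < γ) (k : ℕ) : poch γ k ≤ (1 + γ) ^ k * k.factorial := by
  induction k with
  | zero => simp [poch, (Real.Gamma_pos_of_pos hγ).ne']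
  | succ k ih =>
    have h : poch γ (k + 1) = (γ + k) * poch γ k := by
      simp only [poch]
      rw [Nat.cast_succ, ← add_assoc, Real.Gamma_add_one (by positivity), mul_div_assoc]
    rw [h, Nat.factorial_succ, pow_succ]
    push_cast
    have hk : γ + k ≤ (1 + γ) * (k + 1) := by nlinarith [mul_nonneg hγ.le k.cast_nonneg]
    calc (γ + k) * poch γ k ≤ ((1 + γ) * (k + 1)) * ((1 + γ) ^ k * k.factorial) :=
          mul_le_mul hk ih (poch_nonneg hγ k) (by positivity)
      _ = _ := by ring

lemma prabhakar_coeff_nonneg {α β γ : ℝ} (hα : 0 < α) (hβ : 0 < β) (hγ : 0 < γ) (k : ℕ) :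
    0 ≤ poch γ k / (k.factorial * Real.Gamma (α * k + β)) :=
  div_nonneg (poch_nonneg hγ k)
    (mul_nonneg (by positivity) (Real.Gamma_pos_of_pos (by positivity)).le)

lemma entireCoeff_prabhakar {α β γ : ℝ} (hα : 0 < α) (hβ : 0 < β) (hγ : 0 < γ) :
    EntireCoeff fun k => poch γ k / (k.factorial * Real.Gamma (α * k + β)) := by
  intro r hr
  set A : ℝ := 2 * ((1 + γ) * r) with hA
  have hA0 : 0 < A := by positivity
  set M : ℝ := A ^ α⁻¹ with hM
  have hM0 : 0 < M := by positivity
  have hMα : M ^ α = A := Real.rpow_inv_rpow hA0.le hα.ne'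
  set C : ℝ := Real.exp (-M) * M ^ (β - 1) with hC
  have hC0 : 0 < C := by positivity
  refine Summable.of_norm_bounded_eventually_nat (g := fun k => C⁻¹ * (1 / 2 : ℝ) ^ k)
    (summable_geometric_two.mul_left _) ?_
  filter_upwards [Filter.eventually_ge_atTop ⌈α⁻¹⌉₊] with k hk
  have hk1 : 1 ≤ α * k := by
    have := Nat.ceil_le.1 hk
    rwa [inv_le_iff_one_le_mul₀' hα] at this
  have hG : C * A ^ k ≤ Real.Gamma (α * k + β) := by
    refine le_trans (le_of_eq ?_) (exp_neg_mul_rpow_le_Gamma hM0 (by linarith))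
    rw [← hMα, ← Real.rpow_mul_natCast hM0.le, hC, mul_assoc, ← Real.rpow_add hM0]
    ring_nf
  have hnn := prabhakar_coeff_nonneg hα hβ hγ k
  rw [Real.norm_eq_abs, abs_of_nonneg (by positivity), abs_of_nonneg hnn]
  calc poch γ k / (k.factorial * Real.Gamma (α * k + β)) * r ^ k
      ≤ ((1 + γ) ^ k * k.factorial) / (k.factorial * (C * A ^ k)) * r ^ k := by
        gcongr
        exact poch_le hγ k
    _ = C⁻¹ * (1 / 2 : ℝ) ^ k := by
        rw [hA, mul_pow, mul_pow, div_pow, one_pow]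
        field_simp

/-- First-order Laguerre inequality for the Prabhakar function:
`F(t)[F'(t) + t F''(t)] ≥ t (F'(t))²` where `F = E_{α,β}^γ`. -/
theorem prabhakar_laguerre_inequality (α β γ t : ℝ) (hα : 0 < α) (hβ : 0 < β) (hγ : 0 < γ)
    (ht : 0 < t) :
    prabhakar α β γ t
        * (deriv (fun x => prabhakar α β γ x) t
            + t * deriv (deriv (fun x => prabhakar α β γ x)) t)
      ≥ t * (deriv (fun x => prabhakar α β γ x) t) ^ 2 := by
  have hF : (fun x => prabhakar α β γ x)
      = fun x => ∑' k : ℕ, poch γ k / (k.factorial * Real.Gamma (α * k + β)) * x ^ k :=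
    funext fun x => tsum_congr fun k => mul_div_right_comm _ _ _
  have hc := entireCoeff_prabhakar hα hβ hγ
  have h1 := funext fun x => (hc.hasDerivAt x).deriv
  rw [congrFun hF t, hF, h1, (hc.entire_derivCoeff.hasDerivAt t).deriv]
  exact hc.laguerre (prabhakar_coeff_nonneg hα hβ hγ) ht
end

section
/- Let α ≥ 1, γ > 0, and β > 0 be real with the Gamma function nondecreasing on [β, ∞) (which holds exactly when β ≥ t₀, t₀ being the unique positive minimum point of Γ). Writing F(t) = E_{α,β}^γ(t) and defining the Laguerreian difference Δ_L(t) = (F'(t))² − F(t) F''(t), one has for every t > 0: Δ_L(t) ≤ γ ₁F₁(γ; β; t) ₁F₁(γ+1; α+β; t) / ( t Γ(β) Γ(α+β) ). -/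
open scoped BigOperators

lemma poch_succ_left {γ : ℝ} (hγ : 0 < γ) (k : ℕ) : poch γ (k + 1) = γ * poch (γ + 1) k := by
  have h := (Real.Gamma_pos_of_pos hγ).ne'
  simp only [poch, Nat.cast_add, Nat.cast_one]
  rw [Real.Gamma_add_one hγ.ne', add_right_comm, add_assoc γ (k : ℝ) 1, add_comm (k : ℝ) 1,
    ← add_assoc]
  field_simp

/-- The coefficient of `x ^ k` in the series defining `prabhakar α β γ x`. -/
noncomputable def prabhakarCoeff (α β γ : ℝ) (k : ℕ) : ℝ :=
  poch γ k / (k.factorial * Real.Gamma (α * k + β))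

lemma prabhakar_eq_tsum (α β γ x : ℝ) :
    prabhakar α β γ x = ∑' k : ℕ, prabhakarCoeff α β γ k * x ^ k :=
  tsum_congr fun k => by rw [prabhakarCoeff]; ring

lemma prabhakarCoeff_pos {α β γ : ℝ} (hα : 0 ≤ α) (hβ : 0 < β) (hγ : 0 < γ) (k : ℕ) :
    0 < prabhakarCoeff α β γ k :=
  div_pos (poch_pos hγ k) (mul_pos (by positivity) (Real.Gamma_pos_of_pos (by positivity)))

lemma succ_mul_prabhakarCoeff_succ {α β γ : ℝ} (hγ : 0 < γ) (k : ℕ) :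
    ((k + 1 : ℕ) : ℝ) * prabhakarCoeff α β γ (k + 1)
      = γ * prabhakarCoeff α (α + β) (γ + 1) k := by
  have h : α * ((k + 1 : ℕ) : ℝ) + β = α * k + (α + β) := by push_cast; ring
  have hk : ((k + 1 : ℕ) : ℝ) ≠ 0 := by positivity
  rw [prabhakarCoeff, prabhakarCoeff, poch_succ_left hγ, h, Nat.factorial_succ, Nat.cast_mul,
    mul_assoc, ← mul_div_assoc, mul_div_mul_left _ _ hk, mul_div_assoc]

lemma kummer_term_eq {a b : ℝ} (k : ℕ) (z : ℝ) :
    (poch a k / poch b k) * z ^ k / k.factorial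
      = Real.Gamma b * (prabhakarCoeff 1 b a k * z ^ k) := by
  rw [prabhakarCoeff, poch.eq_1 b, one_mul, add_comm (k : ℝ) b]
  simp only [div_eq_mul_inv, mul_inv, inv_inv]
  ring

lemma summable_prabhakarCoeff_one {a b : ℝ} (ha : 0 < a) (hb : 0 < b) {z : ℝ} (hz : 0 < z) :
    Summable fun k : ℕ => prabhakarCoeff 1 b a k * z ^ k := by
  have hpos : ∀ k : ℕ, 0 < prabhakarCoeff 1 b a k * z ^ k := fun k =>
    mul_pos (prabhakarCoeff_pos zero_le_one hb ha k) (by positivity)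
  refine summable_of_ratio_test_tendsto_lt_one (l := 0) zero_lt_one
    (Filter.Eventually.of_forall fun k => (hpos k).ne') ?_
  have hratio : ∀ k : ℕ, ‖prabhakarCoeff 1 b a (k + 1) * z ^ (k + 1)‖
      / ‖prabhakarCoeff 1 b a k * z ^ k‖ = (a + k) / (b + k) * (z * (1 / ((k : ℝ) + 1))) := by
    intro k
    have hG : Real.Gamma (1 * ((k + 1 : ℕ) : ℝ) + b) = (b + k) * Real.Gamma (1 * k + b) := by
      rw [show (1 * ((k + 1 : ℕ) : ℝ) + b) = (1 * k + b) + 1 by push_cast; ring,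
        Real.Gamma_add_one (by positivity)]
      ring
    have h1 := (Real.Gamma_pos_of_pos (show 0 < 1 * (k : ℝ) + b by positivity)).ne'
    have h2 := (poch_pos ha k).ne'
    have h3 : b + k ≠ 0 := by positivity
    rw [Real.norm_of_nonneg (hpos _).le, Real.norm_of_nonneg (hpos _).le, prabhakarCoeff,
      prabhakarCoeff, hG, poch_succ ha, Nat.factorial_succ, pow_succ]
    push_cast
    field_simp
  simp_rw [hratio]
  have h1 : Filter.Tendsto (fun k : ℕ => (a + k) / (b + k)) Filter.atTop (nhds 1) := by
    simpa using tendsto_add_mul_div_add_mul_atTop_nhds a b (1 : ℝ) one_ne_zero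
  simpa using h1.mul ((tendsto_one_div_add_atTop_nhds_zero_nat (𝕜 := ℝ)).const_mul z)

lemma prabhakarCoeff_le {α β γ : ℝ} (hα : 1 ≤ α) (hβ : 0 < β) (hγ : 0 < γ)
    (hmono : MonotoneOn Real.Gamma (Set.Ici β)) (k : ℕ) :
    prabhakarCoeff α β γ k ≤ prabhakarCoeff 1 β γ k := by
  have hk : (1 : ℝ) * k ≤ α * k := by gcongr
  have hk0 : (0 : ℝ) ≤ k := k.cast_nonneg
  have hG := hmono (show β ≤ 1 * k + β by linarith) (show β ≤ α * k + β by linarith)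
    (by linarith)
  have := poch_pos hγ k
  have := Real.Gamma_pos_of_pos (show 0 < 1 * (k : ℝ) + β by positivity)
  unfold prabhakarCoeff
  gcongr

lemma summable_prabhakarCoeff {α β γ : ℝ} (hα : 1 ≤ α) (hβ : 0 < β) (hγ : 0 < γ)
    (hmono : MonotoneOn Real.Gamma (Set.Ici β)) {r : ℝ} (hr : 0 < r) :
    Summable fun k : ℕ => prabhakarCoeff α β γ k * r ^ k :=
  (summable_prabhakarCoeff_one hγ hβ hr).of_nonneg_of_le
    (fun k => mul_nonneg (prabhakarCoeff_pos (by linarith) hβ hγ k).le (by positivity))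
    (fun k => mul_le_mul_of_nonneg_right (prabhakarCoeff_le hα hβ hγ hmono k) (by positivity))

lemma prabhakar_le_kummer {α β γ : ℝ} (hα : 1 ≤ α) (hβ : 0 < β) (hγ : 0 < γ)
    (hmono : MonotoneOn Real.Gamma (Set.Ici β)) {t : ℝ} (ht : 0 < t) :
    prabhakar α β γ t ≤ kummer γ β t / Real.Gamma β := by
  have hG := (Real.Gamma_pos_of_pos hβ).ne'
  have hK : kummer γ β t / Real.Gamma β = ∑' k : ℕ, prabhakarCoeff 1 β γ k * t ^ k := by
    rw [kummer, tsum_congr fun k => kummer_term_eq k t, tsum_mul_left, mul_div_cancel_left₀ _ hG]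
  rw [hK, prabhakar_eq_tsum]
  exact (summable_prabhakarCoeff hα hβ hγ hmono ht).tsum_le_tsum
    (fun k => mul_le_mul_of_nonneg_right (prabhakarCoeff_le hα hβ hγ hmono k) (by positivity))
    (summable_prabhakarCoeff_one hγ hβ ht)

lemma prabhakar_pos {α β γ : ℝ} (hα : 1 ≤ α) (hβ : 0 < β) (hγ : 0 < γ)
    (hmono : MonotoneOn Real.Gamma (Set.Ici β)) {t : ℝ} (ht : 0 < t) :
    0 < prabhakar α β γ t := by
  have hpos : ∀ k : ℕ, 0 < prabhakarCoeff α β γ k * t ^ k := fun k =>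
    mul_pos (prabhakarCoeff_pos (by linarith) hβ hγ k) (by positivity)
  rw [prabhakar_eq_tsum]
  exact (summable_prabhakarCoeff hα hβ hγ hmono ht).tsum_pos (fun k => (hpos k).le) 0 (hpos 0)

lemma hasSum_prabhakar {α β γ : ℝ} (hα : 1 ≤ α) (hβ : 0 < β) (hγ : 0 < γ)
    (hmono : MonotoneOn Real.Gamma (Set.Ici β)) {t : ℝ} (ht : 0 < t) :
    HasSum (fun k : ℕ => prabhakarCoeff α β γ k * t ^ k) (prabhakar α β γ t) := by
  rw [prabhakar_eq_tsum]
  exact (summable_prabhakarCoeff hα hβ hγ hmono ht).hasSum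

lemma monotoneOn_Gamma_Ici_add {α β : ℝ} (hα : 0 ≤ α)
    (hmono : MonotoneOn Real.Gamma (Set.Ici β)) :
    MonotoneOn Real.Gamma (Set.Ici (α + β)) :=
  hmono.mono (Set.Ici_subset_Ici.mpr (by linarith))

lemma hasSum_natCast_mul_prabhakarCoeff {α β γ : ℝ} (hα : 1 ≤ α) (hβ : 0 < β) (hγ : 0 < γ)
    (hmono : MonotoneOn Real.Gamma (Set.Ici β)) {t : ℝ} (ht : 0 < t) :
    HasSum (fun k : ℕ => prabhakarCoeff α β γ k * (k * t ^ (k - 1)))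
      (γ * prabhakar α (α + β) (γ + 1) t) := by
  have h := (hasSum_prabhakar hα (by linarith) (by linarith : 0 < γ + 1)
    (monotoneOn_Gamma_Ici_add (by linarith : 0 ≤ α) hmono) ht).mul_left γ
  rw [← hasSum_nat_add_iff' 1]
  simp only [Finset.range_one, Finset.sum_singleton, Nat.cast_zero, zero_mul, mul_zero, sub_zero]
  refine h.congr_fun fun k => ?_
  rw [← mul_assoc γ, ← succ_mul_prabhakarCoeff_succ hγ, Nat.add_sub_cancel]
  ring

lemma hasDerivAt_prabhakar {α β γ : ℝ} (hα : 1 ≤ α) (hβ : 0 < β) (hγ : 0 < γ)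
    (hmono : MonotoneOn Real.Gamma (Set.Ici β)) {t : ℝ} (ht : 0 < t) :
    HasDerivAt (fun x => prabhakar α β γ x) (γ * prabhakar α (α + β) (γ + 1) t) t := by
  have hmem : t ∈ Set.Ioo 0 (t + 1) := ⟨ht, by linarith⟩
  have h := hasDerivAt_tsum_of_isPreconnected
    (g := fun (k : ℕ) x => prabhakarCoeff α β γ k * x ^ k)
    (g' := fun (k : ℕ) x => prabhakarCoeff α β γ k * (k * x ^ (k - 1)))
    (hasSum_natCast_mul_prabhakarCoeff hα hβ hγ hmono (by linarith : 0 < t + 1)).summable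
    isOpen_Ioo isPreconnected_Ioo (fun k y _ => (hasDerivAt_pow k y).const_mul _)
    (fun k y hy => ?_) hmem (summable_prabhakarCoeff hα hβ hγ hmono ht) hmem
  · rw [(hasSum_natCast_mul_prabhakarCoeff hα hβ hγ hmono ht).tsum_eq] at h
    simpa only [prabhakar_eq_tsum α β γ] using h
  · have hc := prabhakarCoeff_pos (by linarith : 0 ≤ α) hβ hγ k
    have hy0 := hy.1
    have hy1 := hy.2.le
    rw [Real.norm_of_nonneg (by positivity)]
    gcongr

lemma hasSum_natCast_mul_pred_mul_prabhakarCoeff {α β γ : ℝ} (hα : 1 ≤ α) (hβ : 0 < β)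
    (hγ : 0 < γ) (hmono : MonotoneOn Real.Gamma (Set.Ici β)) {t : ℝ} (ht : 0 < t) :
    HasSum (fun k : ℕ => prabhakarCoeff α β γ k * t ^ k * (k * (k - 1)))
      (t ^ 2 * (γ * ((γ + 1) * prabhakar α (α + (α + β)) (γ + 1 + 1) t))) := by
  have h := ((hasSum_natCast_mul_prabhakarCoeff hα (by linarith) (by linarith : 0 < γ + 1)
    (monotoneOn_Gamma_Ici_add (by linarith : 0 ≤ α) hmono) ht).mul_left γ).mul_left (t ^ 2)
  rw [← hasSum_nat_add_iff' 1]
  simp only [Finset.range_one, Finset.sum_singleton, Nat.cast_zero, zero_mul, mul_zero, sub_zero]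
  refine h.congr_fun fun k => ?_
  rw [← mul_assoc γ, ← succ_mul_prabhakarCoeff_succ hγ]
  rcases k with _ | k
  · simp
  · rw [Nat.add_sub_cancel]
    push_cast
    ring

/-- Cauchy–Schwarz for the first two moments of a nonnegative weight `w` on `ℕ`, stated with the
second factorial moment. -/
lemma sq_moment_le_of_hasSum {w : ℕ → ℝ} (hw : ∀ k, 0 ≤ w k) {s₀ s₁ s₂ : ℝ} (hs₀ : 0 < s₀)
    (h₀ : HasSum w s₀) (h₁ : HasSum (fun k => w k * k) s₁)
    (h₂ : HasSum (fun k => w k * (k * (k - 1))) s₂) : s₁ ^ 2 ≤ s₀ * (s₂ + s₁) := by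
  have h := (((h₂.add h₁).mul_left (s₀ ^ 2)).sub (h₁.mul_left (2 * s₀ * s₁))).add
    (h₀.mul_left (s₁ ^ 2))
  have hnn := h.nonneg fun k => by
    have := mul_nonneg (hw k) (sq_nonneg (s₀ * k - s₁))
    linarith
  refine le_of_mul_le_mul_left ?_ hs₀
  linarith

/-- Kummer-type functional upper bound for the Laguerreian difference:
`Δ_L(t) = (F'(t))² − F(t)F''(t) ≤ γ ₁F₁(γ;β;t) ₁F₁(γ+1;α+β;t)/(t Γ(β) Γ(α+β))`. -/
theorem laguerreian_difference_kummer_bound (α β γ : ℝ) (hα : 1 ≤ α) (hβ : 0 < β)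
    (hγ : 0 < γ) (hmono : MonotoneOn Real.Gamma (Set.Ici β)) (t : ℝ) (ht : 0 < t) :
    (deriv (fun x => prabhakar α β γ x) t) ^ 2
        - prabhakar α β γ t * deriv (deriv (fun x => prabhakar α β γ x)) t
      ≤ γ * kummer γ β t * kummer (γ + 1) (α + β) t / (t * Real.Gamma β * Real.Gamma (α + β)) := by
  have hβ' : 0 < α + β := by linarith
  have hγ' : 0 < γ + 1 := by linarith
  have hmono' := monotoneOn_Gamma_Ici_add (by linarith : 0 ≤ α) hmono
  have hd : ∀ x, 0 < x → deriv (fun x => prabhakar α β γ x) x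
      = γ * prabhakar α (α + β) (γ + 1) x := fun x hx =>
    (hasDerivAt_prabhakar hα hβ hγ hmono hx).deriv
  have hd₂ : deriv (deriv (fun x => prabhakar α β γ x)) t
      = γ * ((γ + 1) * prabhakar α (α + (α + β)) (γ + 1 + 1) t) := by
    rw [Filter.EventuallyEq.deriv_eq ((lt_mem_nhds ht).mono hd)]
    exact ((hasDerivAt_prabhakar hα hβ' hγ' hmono' ht).const_mul γ).deriv
  have hF := prabhakar_pos hα hβ hγ hmono ht
  have hF' := prabhakar_pos hα hβ' hγ' hmono' ht
  have hle := prabhakar_le_kummer hα hβ hγ hmono ht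
  have hle' := prabhakar_le_kummer hα hβ' hγ' hmono' ht
  have h₁ : HasSum (fun k : ℕ => prabhakarCoeff α β γ k * t ^ k * k)
      (t * (γ * prabhakar α (α + β) (γ + 1) t)) := by
    refine ((hasSum_natCast_mul_prabhakarCoeff hα hβ hγ hmono ht).mul_left t).congr_fun
      fun k => ?_
    rcases k with _ | k
    · simp
    · rw [Nat.add_sub_cancel]
      ring
  have hcs := sq_moment_le_of_hasSum
    (fun k => mul_nonneg (prabhakarCoeff_pos (by linarith) hβ hγ k).le (by positivity)) hF
    (hasSum_prabhakar hα hβ hγ hmono ht) h₁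
    (hasSum_natCast_mul_pred_mul_prabhakarCoeff hα hβ hγ hmono ht)
  rw [hd t ht, hd₂]
  calc
    _ ≤ γ * (prabhakar α β γ t * prabhakar α (α + β) (γ + 1) t) / t := by
      rw [le_div_iff₀ ht]
      refine le_of_mul_le_mul_left ?_ ht
      linarith
    _ ≤ γ * (kummer γ β t / Real.Gamma β
          * (kummer (γ + 1) (α + β) t / Real.Gamma (α + β))) / t := by
      have := hF.le.trans hle
      gcongr
    _ = _ := by
      simp only [div_eq_mul_inv, mul_inv]
      ring
end
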